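/- arXiv:2504.20709 — 9 statements merged into one kernel-verified Lean document; each statement's English description precedes it below -/
import Mathlib

section
/- Let d be a positive integer and let S ⊆ ℝ^d be a Meyer set. If liminf_{T→∞} N_S(T)/T^d = 0, then S has a non-trivial annihilator; in particular, there exist m ≥ 1 and nonzero vectors v_1, …, v_m ∈ ℝ^d such that the indicator function 1_S : ℝ^d → ℂ is annihilated by the product of difference ℝ^d-polynomials (X^{v_1}−1)⋯(X^{v_m}−1), i.e., Δ_{v_1}∘⋯∘Δ_{v_m}(1_S) = 0. -/
/- STATEMENT 7: A Meyer set with liminf N_S(T)/T^d = 0 has a non-trivial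
   annihilator; in particular an annihilator which is a product of difference
   ℝ^d-polynomials. -/

open scoped Pointwise

noncomputable section

abbrev Euc (d : ℕ) := EuclideanSpace ℝ (Fin d)

def conv {d : ℕ} (f c : Euc d → ℂ) (u : Euc d) : ℂ := ∑ᶠ v, f v * c (u - v)

def Annihilates {d : ℕ} (f c : Euc d → ℂ) : Prop := ∀ u, conv f c u = 0

def Delta {d : ℕ} (v : Euc d) (c : Euc d → ℂ) : Euc d → ℂ := fun u => c (u - v) - c u

def UniformlyDiscrete {d : ℕ} (S : Set (Euc d)) : Prop :=
  ∃ r > (0:ℝ), ∀ x : Euc d, (S ∩ Metric.ball x r).Subsingleton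

def RelativelyDense {d : ℕ} (S : Set (Euc d)) : Prop :=
  ∃ R > (0:ℝ), ∀ x : Euc d, (S ∩ Metric.closedBall x R).Nonempty

def IsDelone {d : ℕ} (S : Set (Euc d)) : Prop := UniformlyDiscrete S ∧ RelativelyDense S

def IsMeyer {d : ℕ} (S : Set (Euc d)) : Prop := IsDelone S ∧ IsDelone (S - S)

/-- The set of `T`-patches of `S` translated to the origin. -/
def patches {d : ℕ} (S : Set (Euc d)) (T : ℝ) : Set (Set (Euc d)) :=
  {P | ∃ s ∈ S, P = (fun x => x - s) '' (S ∩ Metric.closedBall s T)}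


lemma UD_bound {d : ℕ} {U : Set (Euc d)} (hU : UniformlyDiscrete U) (ρ : ℝ) :
    ∃ K : ℕ, ∀ x, (U ∩ Metric.closedBall x ρ).encard ≤ K := by
  obtain ⟨r, hr, h⟩ := hU
  obtain ⟨t, -, htf, ht⟩ := Metric.totallyBounded_iff.1 (isCompact_closedBall (0 : Euc d) ρ).totallyBounded r hr |>.imp (fun t h => (⟨trivial, h.1, h.2⟩ : True ∧ _ ∧ _))
  refine ⟨t.ncard, fun x => ?_⟩
  have key : ∀ y ∈ U ∩ Metric.closedBall x ρ, ∃ z ∈ t, y ∈ Metric.ball (x + z) r := by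
    intro y hy
    have h1 : y - x ∈ Metric.closedBall (0 : Euc d) ρ := by
      have := hy.2
      simpa [dist_eq_norm] using this
    have := ht h1
    simp only [Set.mem_iUnion] at this
    obtain ⟨z, hz, hz2⟩ := this
    refine ⟨z, hz, ?_⟩
    rw [mem_ball_iff_norm] at hz2 ⊢
    convert hz2 using 2
    abel
  choose! f hf1 hf2 using key
  rw [htf.cast_ncard_eq]
  refine Set.encard_le_encard_of_injOn (f := f) hf1 ?_
  intro y hy z hz hyz
  refine h (x + f y) ⟨hy.1, hf2 y hy⟩ ⟨hz.1, ?_⟩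
  rw [hyz]; exact hf2 z hz

def iterSum {d : ℕ} (P : Set (Euc d)) : ℕ → Set (Euc d)
  | 0 => {0}
  | n + 1 => P + iterSum P n

lemma iterSum_finite {d : ℕ} {P : Set (Euc d)} (hP : P.Finite) (n : ℕ) : (iterSum P n).Finite := by
  induction n with
  | zero => exact Set.finite_singleton _
  | succ n ih => exact hP.add ih

lemma reach_bound {d : ℕ} {V P : Set (Euc d)} {K : ℕ} (hV : V.encard ≤ K)
    (hsym : ∀ p ∈ P, -p ∈ P) {x y : Euc d} (hx : x ∈ V)
    (h : Relation.ReflTransGen (fun u v => v ∈ V ∧ v - u ∈ P) x y) :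
    y - x ∈ ⋃ n ∈ Finset.range (K + 1), iterSum P n := by
  have hVf : V.Finite := Set.finite_of_encard_le_coe hV
  have : Fintype V := hVf.fintype
  let G : SimpleGraph V := SimpleGraph.fromRel (fun u v => (v : Euc d) - u ∈ P)
  have h1 : ∃ hy : y ∈ V, G.Reachable ⟨x, hx⟩ ⟨y, hy⟩ := by
    induction h with
    | refl => exact ⟨hx, SimpleGraph.Reachable.refl _⟩
    | tail _ h2 ih =>
      rename_i b c _
      obtain ⟨hb, hr⟩ := ih
      refine ⟨h2.1, ?_⟩
      by_cases hbc : b = c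
      · subst hbc; exact hr
      · refine hr.trans (SimpleGraph.Adj.reachable ?_)
        rw [SimpleGraph.fromRel_adj]
        exact ⟨by simpa using hbc, Or.inl h2.2⟩
  obtain ⟨hy, ⟨w⟩⟩ := h1
  classical
  have hlen := (w.toPath.2).length_lt
  have hcard : Fintype.card V ≤ K := by
    have : ((Fintype.card V : ℕ) : ℕ∞) ≤ K := by
      rw [← Set.coe_fintypeCard]  at hV
      exact hV
    exact_mod_cast this
  have h2 : ∀ {u v : V} (q : G.Walk u v), (v : Euc d) - u ∈ iterSum P q.length := by
    intro u v q
    induction q with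
    | nil => simp [iterSum]
    | cons hadj q ih =>
      rename_i a b c
      rw [SimpleGraph.Walk.length_cons]
      refine ⟨(b : Euc d) - a, ?_, _, ih, by simp⟩
      rw [SimpleGraph.fromRel_adj] at hadj
      rcases hadj.2 with h | h
      · exact h
      · simpa using hsym _ h
  simp only [Set.mem_iUnion]
  exact ⟨_, Finset.mem_range.2 (by omega), h2 w.toPath.1⟩

lemma meyer_aux {d : ℕ} {S : Set (Euc d)} (hS : IsMeyer S) (ρ : ℝ) (hρ : 0 ≤ ρ) :
    ∃ G : Set (Euc d), G.Finite ∧ ∀ x ∈ S - S, ∀ y ∈ S - S, ‖y - x‖ ≤ ρ → y - x ∈ G := by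
  obtain ⟨⟨hUD, R, hR, hRD⟩, hUD2, -⟩ := hS
  obtain ⟨K, hK⟩ := UD_bound hUD2 (R + ρ)
  obtain ⟨K', hK'⟩ := UD_bound hUD2 (2 * (R + ρ) + 2 * R + 1)
  set Φ : Set (Euc d) := (S - S) ∩ Metric.closedBall 0 (2 * (R + ρ) + 2 * R + 1) with hΦ
  have hΦf : Φ.Finite := Set.finite_of_encard_le_coe (hK' 0)
  set P : Set (Euc d) := Φ - Φ with hP
  have hPf : P.Finite := hΦf.sub hΦf
  have hsym : ∀ p ∈ P, -p ∈ P := by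
    rintro _ ⟨a, ha, b, hb, rfl⟩
    exact ⟨b, hb, a, ha, by simp⟩
  have near : ∀ q : Euc d, ∃ w ∈ S, ‖w - q‖ ≤ R := by
    intro q
    obtain ⟨w, hw, hw2⟩ := hRD q
    exact ⟨w, hw, by simpa [dist_eq_norm] using hw2⟩
  refine ⟨⋃ n ∈ Finset.range (K + 1), iterSum P n, ?_, ?_⟩
  · exact (Finset.range (K + 1)).finite_toSet.biUnion (fun n _ => iterSum_finite hPf n)
  rintro x ⟨a, ha, b, hb, hxab⟩ y ⟨c, hc, e, he, hyce⟩ hxy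
  simp only at hxab hyce
  have hx0 : x ∈ S - S := ⟨a, ha, b, hb, hxab⟩
  refine reach_bound (V := (S - S) ∩ Metric.closedBall x (R + ρ)) (hK x) hsym
    ⟨hx0, Metric.mem_closedBall_self (by positivity)⟩ ?_
  obtain ⟨n, hn⟩ := exists_nat_gt ‖e - b‖
  have hn0 : (0 : ℝ) < n := lt_of_le_of_lt (norm_nonneg _) hn
  have main : ∀ i : ℕ, ∀ w ∈ S, ∀ w' ∈ S, ‖w - (b + ((i : ℝ) / n) • (e - b))‖ ≤ R →
      ‖w' - w - x‖ ≤ R + ρ →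
      Relation.ReflTransGen (fun u v => v ∈ (S - S) ∩ Metric.closedBall x (R + ρ) ∧ v - u ∈ P)
        x (w' - w) := by
    intro i
    induction i with
    | zero =>
      intro w hw w' hw' h1 h2
      simp only [Nat.cast_zero, zero_div, zero_smul, add_zero] at h1
      refine Relation.ReflTransGen.single ⟨⟨⟨w', hw', w, hw, rfl⟩, ?_⟩, ?_⟩
      · rwa [mem_closedBall_iff_norm]
      · refine ⟨w' - a, ⟨⟨w', hw', a, ha, rfl⟩, ?_⟩, w - b, ⟨⟨w, hw, b, hb, rfl⟩, ?_⟩, ?_⟩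
        · rw [mem_closedBall_zero_iff]
          have : w' - a = (w' - w - x) + (w - b) := by rw [← hxab]; abel
          rw [this]
          refine (norm_add_le _ _).trans ?_
          linarith
        · rw [mem_closedBall_zero_iff]
          linarith
        · simp only [← hxab]; abel
    | succ i ih =>
      intro w hw w' hw' h1 h2
      obtain ⟨v, hv, hv1⟩ := near (b + ((i : ℝ) / n) • (e - b))
      obtain ⟨v', hv', hv1'⟩ := near (v + x)
      have hv2 : ‖v' - v - x‖ ≤ R := by rwa [sub_sub]
      have hwv : ‖w - v‖ ≤ 2 * R + 1 := by
        have : w - v = (w - (b + (((i + 1 : ℕ) : ℝ) / n) • (e - b)))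
            - (v - (b + ((i : ℝ) / n) • (e - b))) + ((1 : ℝ) / n) • (e - b) := by
          push_cast
          module
        rw [this]
        have h3 : ‖((1 : ℝ) / n) • (e - b)‖ ≤ 1 := by
          rw [norm_smul, Real.norm_of_nonneg (by positivity), one_div, inv_mul_le_iff₀ hn0]
          linarith
        have h4 := norm_add_le ((w - (b + (((i + 1 : ℕ) : ℝ) / n) • (e - b)))
            - (v - (b + ((i : ℝ) / n) • (e - b)))) (((1 : ℝ) / n) • (e - b))
        have h5 := norm_sub_le (w - (b + (((i + 1 : ℕ) : ℝ) / n) • (e - b)))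
            (v - (b + ((i : ℝ) / n) • (e - b)))
        linarith
      have hwv' : ‖w' - v'‖ ≤ 2 * (R + ρ) + 2 * R + 1 := by
        have : w' - v' = (w' - w - x) - (v' - v - x) + (w - v) := by abel
        rw [this]
        have h4 := norm_add_le ((w' - w - x) - (v' - v - x)) (w - v)
        have h5 := norm_sub_le (w' - w - x) (v' - v - x)
        linarith
      refine (ih v hv v' hv' hv1 (by linarith)).tail ⟨⟨⟨w', hw', w, hw, rfl⟩, ?_⟩, ?_⟩
      · rwa [mem_closedBall_iff_norm]
      · refine ⟨w' - v', ⟨⟨w', hw', v', hv', rfl⟩, ?_⟩, w - v, ⟨⟨w, hw, v, hv, rfl⟩, ?_⟩, ?_⟩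
        · rwa [mem_closedBall_zero_iff]
        · rw [mem_closedBall_zero_iff]
          linarith
        · simp only; abel
  have := main n e he c hc (by
    rw [div_self hn0.ne']; simp [hR.le]) (by rw [hyce]; linarith)
  rwa [hyce] at this

lemma meyer {d : ℕ} {S : Set (Euc d)} (hS : IsMeyer S) :
    ∃ F : Set (Euc d), F.Finite ∧ ∀ u ∈ S - S, ∃ t ∈ S, ∃ φ ∈ F, u = t + φ := by
  have hS' := hS
  obtain ⟨⟨hUD, R, hR, hRD⟩, hUD2, -⟩ := hS'
  obtain ⟨G, hG, h⟩ := meyer_aux hS R hR.le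
  obtain ⟨s0, hs0, -⟩ := hRD 0
  refine ⟨(fun g => g - s0) '' G, hG.image _, ?_⟩
  intro u hu
  obtain ⟨t, ht, ht2⟩ := hRD (u + s0)
  rw [mem_closedBall_iff_norm] at ht2
  refine ⟨t, ht, _, ⟨u - (t - s0), h _ ⟨t, ht, s0, hs0, rfl⟩ u hu ?_, rfl⟩, by simp only; abel⟩
  have h2 : u - (t - s0) = -(t - (u + s0)) := by abel
  rwa [h2, norm_neg]

lemma count_lower {d : ℕ} {S : Set (Euc d)} {R : ℝ} (hR : 0 < R)
    (hRD : ∀ x : Euc d, (S ∩ Metric.closedBall x R).Nonempty) {T : ℝ} (hT : R ≤ T)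
    (hf : (S ∩ Metric.closedBall 0 T).Finite) :
    ((T - R) / R) ^ d ≤ ((S ∩ Metric.closedBall 0 T).ncard : ℝ) := by
  have hsub : Metric.closedBall (0 : Euc d) (T - R) ⊆
      ⋃ s ∈ hf.toFinset, Metric.closedBall s R := by
    intro x hx
    obtain ⟨s, hs, hs2⟩ := hRD x
    simp only [Set.mem_iUnion]
    refine ⟨s, ?_, by rwa [Metric.mem_closedBall, dist_comm]⟩
    rw [Set.Finite.mem_toFinset]
    refine ⟨hs, ?_⟩
    rw [Metric.mem_closedBall] at *
    linarith [dist_triangle s x 0]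
  have h1 := (MeasureTheory.measure_mono (μ := MeasureTheory.volume) hsub).trans
    (MeasureTheory.measure_biUnion_finset_le _ _)
  have hv : ∀ (x : Euc d) (r : ℝ), 0 ≤ r → MeasureTheory.volume (Metric.closedBall x r) =
      ENNReal.ofReal (r ^ d) * MeasureTheory.volume (Metric.ball (0 : Euc d) 1) := by
    intro x r hr
    rw [MeasureTheory.Measure.addHaar_closedBall _ _ hr]
    simp
  rw [hv _ _ (by linarith)] at h1
  simp only [hv _ _ hR.le, Finset.sum_const, nsmul_eq_mul] at h1
  rw [← mul_assoc] at h1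
  have hpos : MeasureTheory.volume (Metric.ball (0 : Euc d) 1) ≠ 0 :=
    (Metric.measure_ball_pos _ _ one_pos).ne'
  have hfin : MeasureTheory.volume (Metric.ball (0 : Euc d) 1) ≠ ⊤ :=
    MeasureTheory.measure_ball_lt_top.ne
  rw [ENNReal.mul_le_mul_iff_left hpos hfin, ← ENNReal.ofReal_natCast,
    ← ENNReal.ofReal_mul (by positivity),
    ENNReal.ofReal_le_ofReal_iff (by positivity)] at h1
  rw [div_pow, div_le_iff₀ (by positivity), Set.ncard_eq_toFinset_card _ hf]
  exact h1

lemma patches_small {d : ℕ} {S : Set (Euc d)} 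
    (hliminf : Filter.liminf
      (fun T : ℝ => ((patches S T).encard : ℕ∞) / ENNReal.ofReal (T ^ d))
      Filter.atTop = 0) {ε : ℝ} (hε : 0 < ε) (T0 : ℝ) :
    ∃ T ≥ T0, (patches S T).Finite ∧ ((patches S T).ncard : ℝ) ≤ ε * T ^ d := by
  have h := Filter.frequently_lt_of_liminf_lt (b := ENNReal.ofReal ε)
    (f := Filter.atTop) (u := fun T : ℝ => (((patches S T).encard : ℕ∞) : ENNReal) / ENNReal.ofReal (T ^ d))
    (by isBoundedDefault) (by rw [hliminf]; simpa using hε)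
  obtain ⟨T, hT, hlt⟩ := ((Filter.eventually_ge_atTop (max T0 1)).and_frequently h).exists
  have hT1 : 0 < T ^ d := by
    have : 1 ≤ T := (le_max_right _ _).trans hT
    positivity
  refine ⟨T, (le_max_left _ _).trans hT, ?_⟩
  have hle := hlt.le
  rw [ENNReal.div_le_iff (by simpa using hT1) ENNReal.ofReal_ne_top,
    ← ENNReal.ofReal_mul hε.le] at hle
  have hfin : (patches S T).Finite := by
    rw [← Set.encard_ne_top_iff]
    intro h
    rw [h] at hle
    simp at hle
  refine ⟨hfin, ?_⟩
  rw [← hfin.cast_ncard_eq] at hle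
  simp only [ENat.toENNReal_coe] at hle
  rw [← ENNReal.ofReal_natCast, ENNReal.ofReal_le_ofReal_iff (by positivity)] at hle
  exact hle

lemma pattern_count {d : ℕ} {S F D : Set (Euc d)} (hF : F.Finite)
    (hFS : ∀ u ∈ S - S, ∃ t ∈ S, ∃ φ ∈ F, u = t + φ) {M T : ℝ} (hM : ∀ φ ∈ F, ‖φ‖ ≤ M)
    (hD : D ⊆ S) (hDT : ∀ s ∈ D, ‖s‖ ≤ T) (hfin : (patches S (T + M)).Finite) :
    (Set.range (fun (u : Euc d) (s : D) => Set.indicator S (fun _ => (1 : ℤ)) (u + s))).Finite ∧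
    (Set.range (fun (u : Euc d) (s : D) => Set.indicator S (fun _ => (1 : ℤ)) (u + s))).ncard ≤
      F.ncard * (patches S (T + M)).ncard + 1 := by
  classical
  set Q : Set (D → ℤ) := insert 0 ((fun p : Euc d × Set (Euc d) => fun s : D =>
    Set.indicator p.2 (fun _ => (1 : ℤ)) (p.1 + s)) '' (F ×ˢ patches S (T + M))) with hQ
  have hQf : Q.Finite := ((hF.prod hfin).image _).insert 0
  have hsub : Set.range (fun (u : Euc d) (s : D) => Set.indicator S (fun _ => (1 : ℤ)) (u + s)) ⊆ Q := by
    rintro _ ⟨u, rfl⟩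
    by_cases h0 : ∃ s ∈ D, u + s ∈ S
    · obtain ⟨s, hs, hus⟩ := h0
      obtain ⟨t, ht, φ, hφ, rfl⟩ := hFS u ⟨u + s, hus, s, hD hs, by simp⟩
      refine Set.mem_insert_of_mem _ ⟨(φ, (fun x => x - t) '' (S ∩ Metric.closedBall t (T + M))),
        ⟨hφ, t, ht, rfl⟩, ?_⟩
      funext s
      have : (φ + (s : Euc d) ∈ (fun x => x - t) '' (S ∩ Metric.closedBall t (T + M))) ↔
          t + φ + s ∈ S := by
        constructor
        · rintro ⟨x, hx, hxe⟩
          have : t + φ + s = x := by rw [add_assoc, ← hxe]; simp only; abel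
          rw [this]; exact hx.1
        · intro h
          refine ⟨_, ⟨h, ?_⟩, by simp only; abel⟩
          rw [mem_closedBall_iff_norm]
          have : t + φ + s - t = s + φ := by abel
          rw [this]
          exact (norm_add_le _ _).trans (add_le_add (hDT _ s.2) (hM _ hφ))
      simp only [Set.indicator_apply, this]
    · left
      funext s
      simp only [Pi.zero_apply, Set.indicator_apply_eq_zero]
      intro h
      exact absurd ⟨s, s.2, h⟩ h0
  refine ⟨hQf.subset hsub, (Set.ncard_le_ncard hsub hQf).trans ?_⟩
  refine (Set.ncard_insert_le _ _).trans ?_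
  gcongr
  refine (Set.ncard_image_le (hF.prod hfin)).trans ?_
  rw [Set.ncard_prod]

lemma step_one {d : ℕ} {S : Set (Euc d)} (hS : IsMeyer S)
    (hliminf : Filter.liminf
      (fun T : ℝ => ((patches S T).encard : ℕ∞) / ENNReal.ofReal (T ^ d))
      Filter.atTop = 0) (hd : 0 < d) :
    ∃ (D : Finset (Euc d)) (a : Euc d → ℤ), D.Nonempty ∧ (∀ s ∈ D, a s ≠ 0) ∧
      ∀ u, ∑ s ∈ D, a s * Set.indicator S (fun _ => (1 : ℤ)) (u + s) = 0 := by
  classical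
  obtain ⟨F, hF, hFS⟩ := meyer hS
  obtain ⟨⟨hUD, R, hR, hRD⟩, hUD2, -⟩ := hS
  obtain ⟨M, hM⟩ : ∃ M : ℝ, ∀ φ ∈ F, ‖φ‖ ≤ M := by
    obtain ⟨M, hM⟩ := hF.isBounded.exists_norm_le
    exact ⟨M, hM⟩
  set C : ℝ := (1 / (2 * R)) ^ d with hC
  have hCpos : 0 < C := by positivity
  -- choose T
  obtain ⟨T1, hT1⟩ : ∃ T1 : ℝ, ∀ T ≥ T1, 2 < C * T ^ d := by
    have : Filter.Tendsto (fun T : ℝ => C * T ^ d) Filter.atTop Filter.atTop :=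
      (Filter.tendsto_pow_atTop hd.ne').const_mul_atTop hCpos
    exact Filter.eventually_atTop.1 (this.eventually_gt_atTop 2)
  obtain ⟨T, hT, hfin, hN⟩ := patches_small hliminf (ε := C / (2 * (F.ncard + 1)))
    (by positivity) (max T1 (max (2 * (R + |M|)) 1))
  have hTa : T1 ≤ T := (le_max_left _ _).trans hT
  have hTb : 2 * (R + |M|) ≤ T := (le_max_left _ _).trans ((le_max_right _ _).trans hT)
  have hTpos : 0 < T := lt_of_lt_of_le one_pos ((le_max_right _ _).trans ((le_max_right _ _).trans hT))
  have hMabs := le_abs_self M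
  have hMabs0 := abs_nonneg M
  set D : Set (Euc d) := S ∩ Metric.closedBall 0 (T - M) with hDdef
  have hDf : D.Finite := by
    obtain ⟨K, hK⟩ := UD_bound hUD (T - M)
    exact Set.finite_of_encard_le_coe (hK 0)
  have hlow := count_lower hR hRD (T := T - M) (by linarith) hDf
  have hlow2 : C * T ^ d ≤ D.ncard := by
    refine le_trans ?_ hlow
    rw [hC, ← mul_pow]
    refine pow_le_pow_left₀ (by positivity) ?_ d
    rw [le_div_iff₀ hR]
    have : 1 / (2 * R) * T * R = T / 2 := by field_simp
    rw [this]; linarith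
  obtain ⟨hPf, hPc⟩ := pattern_count (D := D) hF hFS (M := M) (T := T - M) hM Set.inter_subset_left
    (fun s hs => by simpa using hs.2) (by simpa using hfin)
  rw [sub_add_cancel] at hPc
  set P := Set.range (fun (u : Euc d) (s : D) => Set.indicator S (fun _ => (1 : ℤ)) (u + s)) with hPdef
  have hcard : P.ncard < D.ncard := by
    have h1 : (F.ncard : ℝ) * (patches S T).ncard ≤ C * T ^ d / 2 := by
      calc (F.ncard : ℝ) * (patches S T).ncard 
          ≤ (F.ncard + 1) * (C / (2 * (F.ncard + 1)) * T ^ d) := by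
            gcongr
            linarith
        _ = C * T ^ d / 2 := by field_simp
    have h2 := hT1 T hTa
    have h3 : (P.ncard : ℝ) ≤ F.ncard * (patches S T).ncard + 1 := by exact_mod_cast hPc
    have : (P.ncard : ℝ) < D.ncard := by linarith
    exact_mod_cast this
  have : Fintype P := hPf.fintype
  have : Fintype D := hDf.fintype
  have hcard' : Fintype.card P < Fintype.card D := by
    rwa [← Nat.card_eq_fintype_card, ← Nat.card_eq_fintype_card]
  have hpos : 0 < Fintype.card P := Fintype.card_pos_iff.2 ⟨⟨_, 0, rfl⟩⟩
  obtain ⟨t, ht0, ht, -⟩ := Int.Matrix.exists_ne_zero_int_vec_norm_le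
    (Matrix.of (fun (p : P) (s : D) => (p : D → ℤ) s)) hcard' hpos
  set a : Euc d → ℤ := fun s => if h : s ∈ D then t ⟨s, h⟩ else 0 with ha
  refine ⟨hDf.toFinset.filter (fun s => a s ≠ 0), a, ?_, fun s hs => (Finset.mem_filter.1 hs).2, ?_⟩
  · obtain ⟨s, hs⟩ := Function.ne_iff.1 ht0
    refine ⟨s, Finset.mem_filter.2 ⟨by simp, ?_⟩⟩
    simpa [ha] using hs
  · intro u
    have h1 := congrFun ht ⟨_, u, rfl⟩
    simp only [Matrix.mulVec, dotProduct, Matrix.of_apply, Pi.zero_apply] at h1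
    rw [Finset.sum_filter_of_ne (fun s _ h => left_ne_zero_of_mul h), ← h1]
    refine Finset.sum_bij' (fun s hs => (⟨s, hDf.mem_toFinset.1 hs⟩ : D)) (fun s _ => (s : Euc d))
      (by simp) (by simp) (by simp) (by simp) ?_
    intro s hs
    have hs' : s ∈ D := hDf.mem_toFinset.1 hs
    simp only [ha, hs', dif_pos]
    ring

def shiftHom {d : ℕ} : Multiplicative (Euc d) →* Module.End ℤ (Euc d → ℤ) where
  toFun v := { toFun := fun c u => c (u + v.toAdd)
               map_add' := fun _ _ => rfl
               map_smul' := fun _ _ => rfl }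
  map_one' := by ext; simp
  map_mul' v w := by
    ext c u
    simp [add_assoc]

abbrev RA (d : ℕ) := AddMonoidAlgebra ℤ (Euc d)

def act {d : ℕ} : RA d →ₐ[ℤ] Module.End ℤ (Euc d → ℤ) :=
  AddMonoidAlgebra.lift ℤ (Module.End ℤ (Euc d → ℤ)) (Euc d) shiftHom

def mX {d : ℕ} (v : Euc d) : RA d := AddMonoidAlgebra.single v 1

lemma act_mX {d : ℕ} (v : Euc d) (c : Euc d → ℤ) (u : Euc d) : act (mX v) c u = c (u + v) := by
  simp [act, mX, shiftHom]

lemma mX_add {d : ℕ} (v w : Euc d) : mX (v + w) = mX v * mX w := by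
  simp [mX, AddMonoidAlgebra.single_mul_single]

lemma mX_zero {d : ℕ} : mX (0 : Euc d) = 1 := rfl

lemma mX_nsmul {d : ℕ} (n : ℕ) (v : Euc d) : mX (n • v) = mX v ^ n := by
  simp [mX, AddMonoidAlgebra.single_pow]

def annI {d : ℕ} (c : Euc d → ℤ) : Ideal (RA d) where
  carrier := {f | act f c = 0}
  add_mem' := by
    intro f g hf hg
    simp only [Set.mem_ofPred_eq] at *
    simp [hf, hg]
  zero_mem' := by simp
  smul_mem' := by
    intro f g hg
    simp only [Set.mem_ofPred_eq] at *
    simp [hg]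

lemma mem_annI {d : ℕ} {c : Euc d → ℤ} {f : RA d} : f ∈ annI c ↔ act f c = 0 := Iff.rfl

lemma act_sum {d k : ℕ} (a : Fin k → ℤ) (w : Fin k → Euc d) (c : Euc d → ℤ) (u : Euc d) :
    act (∑ i, (a i : RA d) * mX (w i)) c u = ∑ i, a i * c (u + w i) := by
  simp [act_mX, LinearMap.sum_apply, Finset.sum_apply]

lemma frob {d k : ℕ} (a : Fin k → ℤ) (w : Fin k → Euc d) {p : ℕ} (hp : p.Prime) :
    ∃ r : RA d, (∑ i, (a i : RA d) * mX (w i)) ^ p = (∑ i, (a i : RA d) * mX (p • w i)) + p * r := by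
  have h1 : ∀ (s : Finset (Fin k)) (x : Fin k → RA d), ∃ r, (∑ i ∈ s, x i) ^ p = ∑ i ∈ s, x i ^ p + p * r := by
    classical
    intro s x
    induction s using Finset.induction_on with
    | empty => exact ⟨0, by simp [hp.ne_zero]⟩
    | insert i s hi ih =>
      obtain ⟨r, hr⟩ := ih
      obtain ⟨r', hr'⟩ := exists_add_pow_prime_eq hp (x i) (∑ i ∈ s, x i)
      rw [Finset.sum_insert hi, Finset.sum_insert hi, hr', hr]
      exact ⟨r + x i * (∑ i ∈ s, x i) * r', by ring⟩
  have h2 : ∀ i, ∃ b : ℤ, a i ^ p = a i + p * b := by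
    intro i
    have : (p : ℤ) ∣ a i ^ p - a i := by
      have := Fact.mk hp
      rw [← ZMod.intCast_zmod_eq_zero_iff_dvd]
      simp
    obtain ⟨b, hb⟩ := this
    exact ⟨b, by linarith⟩
  choose b hb using h2
  obtain ⟨r, hr⟩ := h1 Finset.univ (fun i => (a i : RA d) * mX (w i))
  refine ⟨r + ∑ i, (b i : RA d) * mX (p • w i), ?_⟩
  rw [hr, mul_add, Finset.mul_sum, add_comm ((p : RA d) * r), ← add_assoc, ← Finset.sum_add_distrib]
  congr 1
  refine Finset.sum_congr rfl fun i _ => ?_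
  rw [mul_pow, mX_nsmul, ← Int.cast_pow, hb]
  push_cast
  ring

lemma frob_step {d k : ℕ} (a : Fin k → ℤ) (w : Fin k → Euc d) {c : Euc d → ℤ}
    (hc : ∀ u, |c u| ≤ 1) {p : ℕ} (hp : p.Prime) (hlt : ∑ i, |a i| < p)
    (h : ∑ i, (a i : RA d) * mX (w i) ∈ annI c) :
    ∑ i, (a i : RA d) * mX (p • w i) ∈ annI c := by
  obtain ⟨r, hr⟩ := frob a w hp
  have h1 := Ideal.pow_mem_of_mem _ h p hp.pos
  rw [hr, mem_annI, map_add, LinearMap.add_apply] at h1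
  rw [mem_annI]
  funext u
  have h2 := congrFun h1 u
  rw [Pi.add_apply, act_sum] at h2
  rw [act_sum]
  have h3 : act ((p : RA d) * r) c u = p * act r c u := by
    rw [map_mul, map_natCast]
    simp
  rw [h3] at h2
  refine Int.eq_zero_of_abs_lt_dvd (m := p) ?_ ?_
  · exact ⟨- act r c u, by simp only [Pi.zero_apply] at h2; linarith⟩
  · refine lt_of_le_of_lt ((Finset.abs_sum_le_sum_abs _ _).trans ?_) hlt
    refine Finset.sum_le_sum fun i _ => ?_
    rw [abs_mul]
    exact mul_le_of_le_one_right (abs_nonneg _) (hc _)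

lemma frob_all {d k : ℕ} (a : Fin k → ℤ) (w : Fin k → Euc d) {c : Euc d → ℤ}
    (hc : ∀ u, |c u| ≤ 1) (n : ℕ) (hn : n ≠ 0) (hlt : ∀ p : ℕ, p.Prime → p ∣ n → ∑ i, |a i| < p)
    (h : ∑ i, (a i : RA d) * mX (w i) ∈ annI c) :
    ∑ i, (a i : RA d) * mX (n • w i) ∈ annI c := by
  induction n using Nat.recOnMul generalizing w with
  | zero => exact absurd rfl hn
  | one => simpa using h
  | prime p hp => exact frob_step a w hc hp (hlt p hp dvd_rfl) h
  | mul m n ihm ihn =>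
    have := ihn (fun i => m • w i) (right_ne_zero_of_mul hn)
      (fun p hp hd => hlt p hp (hd.mul_left m))
      (ihm w (left_ne_zero_of_mul hn) (fun p hp hd => hlt p hp (hd.mul_right n)) h)
    simpa only [smul_smul, mul_comm n m] using this

lemma step_two {d k : ℕ} (a : Fin k → ℤ) (w : Fin k → Euc d) {c : Euc d → ℤ}
    (hc : ∀ u, |c u| ≤ 1) (hw : Function.Injective w) (i0 : Fin k) (ha : a i0 ≠ 0)
    (h : ∑ i, (a i : RA d) * mX (w i) ∈ annI c) :
    ∃ L : List (Euc d), (∀ v ∈ L, v ≠ 0) ∧ (L.map (fun v => mX (-v) - 1)).prod ∈ annI c := by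
  classical
  obtain ⟨r, hr0, hr⟩ : ∃ r : ℕ, r ≠ 0 ∧ ∀ j p : ℕ, p.Prime → p ∣ 1 + j * r → ∑ i, |a i| < p := by
    refine ⟨(∑ i, |a i|).toNat.factorial, Nat.factorial_ne_zero _, ?_⟩
    intro j p hp hdvd
    by_contra hlt
    push Not at hlt
    have h1 : p ≤ (∑ i, |a i|).toNat := by omega
    have h2 : p ∣ (∑ i, |a i|).toNat.factorial := hp.dvd_factorial.2 h1
    have h3 : p ∣ 1 := (Nat.dvd_add_left (h2.mul_left j)).1 hdvd
    exact hp.one_lt.ne' (Nat.dvd_one.1 h3)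
  set V : Matrix (Fin k) (Fin k) (RA d) := (Matrix.vandermonde (fun i => mX (r • w i))).transpose with hV
  set x : Fin k → RA d := fun i => (a i : RA d) * mX (w i) with hx
  have h1 : ∀ j, V.mulVec x j ∈ annI c := by
    intro j
    have := frob_all a w hc (1 + j * r) (by omega) (fun p hp h => hr j p hp h) h
    convert this using 1
    simp only [Matrix.mulVec, dotProduct, hV, hx, Matrix.transpose_apply, Matrix.vandermonde_apply]
    refine Finset.sum_congr rfl fun i _ => ?_
    rw [add_smul, one_smul, mX_add, mul_comm (j : ℕ) r, mX_nsmul (r * j), pow_mul, ← mX_nsmul r]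
    ring
  have h2 : V.det * x i0 ∈ annI c := by
    have : V.det * x i0 = (V.adjugate.mulVec (V.mulVec x)) i0 := by
      rw [Matrix.mulVec_mulVec, Matrix.adjugate_mul, Matrix.smul_mulVec, Matrix.one_mulVec]
      rfl
    rw [this, Matrix.mulVec, dotProduct]
    exact Ideal.sum_mem _ fun j _ => Ideal.mul_mem_left _ _ (h1 j)
  have hunit : ∀ (v : Euc d) (f : RA d), f * mX v ∈ annI c → f ∈ annI c := by
    intro v f hf
    have := Ideal.mul_mem_right (mX (-v)) _ hf
    rwa [mul_assoc, ← mX_add, add_neg_cancel, mX_zero, mul_one] at this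
  have h3 : V.det ∈ annI c := by
    have h4 : V.det * (a i0 : RA d) ∈ annI c := by
      apply hunit (w i0)
      rw [mul_assoc]; exact h2
    rw [mem_annI] at h4 ⊢
    funext u
    have h5 := congrFun h4 u
    rw [mul_comm, map_mul, map_intCast] at h5
    simpa [ha] using h5
  have hgood : ∃ L : List (Euc d), (∀ v ∈ L, v ≠ 0) ∧ ∃ q, V.det = (L.map (fun v => mX (-v) - 1)).prod * mX q := by
    rw [hV, Matrix.det_transpose, Matrix.det_vandermonde]
    have hmul : ∀ f g : RA d,
      (∃ L : List (Euc d), (∀ v ∈ L, v ≠ 0) ∧ ∃ q, f = (L.map (fun v => mX (-v) - 1)).prod * mX q) →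
      (∃ L : List (Euc d), (∀ v ∈ L, v ≠ 0) ∧ ∃ q, g = (L.map (fun v => mX (-v) - 1)).prod * mX q) →
      (∃ L : List (Euc d), (∀ v ∈ L, v ≠ 0) ∧ ∃ q, f * g = (L.map (fun v => mX (-v) - 1)).prod * mX q) := by
      rintro f g ⟨L, hL, q, rfl⟩ ⟨L', hL', q', rfl⟩
      refine ⟨L ++ L', ?_, q + q', ?_⟩
      · intro v hv
        rcases List.mem_append.1 hv with h | h
        · exact hL v h
        · exact hL' v h
      · rw [List.map_append, List.prod_append, mX_add]; ring
    have hone : ∃ L : List (Euc d), (∀ v ∈ L, v ≠ 0) ∧ ∃ q, (1 : RA d) = (L.map (fun v => mX (-v) - 1)).prod * mX q :=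
      ⟨[], by simp, 0, by simp [mX_zero]⟩
    refine Finset.prod_induction _ _ hmul hone fun i _ => ?_
    refine Finset.prod_induction _ _ hmul hone fun j hj => ?_
    refine ⟨[r • w i - r • w j], ?_, r • w i, ?_⟩
    · intro v hv
      rw [List.mem_singleton] at hv
      rw [hv, ← smul_sub, ← Nat.cast_smul_eq_nsmul ℝ]
      intro h0
      rcases smul_eq_zero.1 h0 with h | h
      · exact hr0 (by exact_mod_cast h)
      · exact (Finset.mem_Ioi.1 hj).ne (hw (sub_eq_zero.1 h))
    · simp only [List.map_cons, List.map_nil, List.prod_cons, List.prod_nil, mul_one, sub_mul, one_mul]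
      rw [← mX_add]
      congr 2
      abel
  obtain ⟨L, hL, q, hq⟩ := hgood
  exact ⟨L, hL, hunit q _ (hq ▸ h3)⟩

lemma foldr_Delta {d : ℕ} (c : Euc d → ℤ) (L : List (Euc d)) :
    L.foldr Delta (fun u => (c u : ℂ)) =
      fun u => ((act (L.map (fun v => mX (-v) - 1)).prod c u : ℤ) : ℂ) := by
  induction L with
  | nil => simp
  | cons v L ih =>
    rw [List.foldr_cons, ih]
    funext u
    simp only [Delta, List.map_cons, List.prod_cons, map_mul, map_sub, map_one, Module.End.mul_apply,
      LinearMap.sub_apply, Pi.sub_apply, act_mX, Module.End.one_apply, sub_eq_add_neg u v]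
    push_cast
    rfl

theorem stmt_7 (d : ℕ) (hd : 0 < d) (S : Set (Euc d)) (hS : IsMeyer S)
    (hliminf : Filter.liminf
      (fun T : ℝ => ((patches S T).encard : ℕ∞) / ENNReal.ofReal (T ^ d))
      Filter.atTop = 0) :
    (∃ f : Euc d → ℂ, (Function.support f).Finite ∧ f ≠ 0 ∧
      Annihilates f (Set.indicator S (fun _ => (1 : ℂ)))) ∧
    (∃ L : List (Euc d), L ≠ [] ∧ (∀ v ∈ L, v ≠ 0) ∧
      L.foldr Delta (Set.indicator S (fun _ => (1 : ℂ))) = 0) := by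
  classical
  obtain ⟨D, a, ⟨s0, hs0⟩, ha, hsum⟩ := step_one hS hliminf hd
  set c : Euc d → ℤ := Set.indicator S (fun _ => (1 : ℤ)) with hc
  have hcC : Set.indicator S (fun _ => (1 : ℂ)) = fun u => (c u : ℂ) := by
    funext u
    by_cases hu : u ∈ S <;> simp [hc, hu]
  rw [hcC]
  constructor
  · set f : Euc d → ℂ := fun v => if -v ∈ D then (a (-v) : ℂ) else 0 with hf
    have hsupp : Function.support f ⊆ (D.image (fun v => -v) : Finset (Euc d)) := by
      intro v hv
      rw [Function.mem_support] at hv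
      have : -v ∈ D := by
        by_contra h
        exact hv (by simp [hf, h])
      rw [Finset.mem_coe]
      exact Finset.mem_image.2 ⟨-v, this, by simp⟩
    refine ⟨f, (Finset.finite_toSet _).subset hsupp, ?_, ?_⟩
    · intro h0
      have := congrFun h0 (-s0)
      simp [hf, hs0, ha s0 hs0] at this
    · intro u
      rw [conv, finsum_eq_sum_of_support_subset (s := D.image (fun v => -v)) _
        (fun v hv => hsupp (left_ne_zero_of_mul hv)),
        Finset.sum_image (fun x _ y _ h => neg_injective h)]
      have h1 : ((∑ s ∈ D, a s * c (u + s) : ℤ) : ℂ) = 0 := by rw [hsum u]; simp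
      rw [← h1]
      push_cast
      refine Finset.sum_congr rfl fun s hs => ?_
      simp [hf, hs]
  · let e := D.equivFin.symm
    have hin : ∑ i, ((a (e i)) : RA d) * mX ((e i : Euc d)) ∈ annI c := by
      rw [mem_annI]
      funext u
      rw [act_sum (fun i => a (e i)) (fun i => (e i : Euc d))]
      rw [Equiv.sum_comp e (fun s : D => a s * c (u + s))]
      rw [Finset.sum_coe_sort D (fun s => a s * c (u + s))]
      exact hsum u
    have hcb : ∀ u, |c u| ≤ 1 := by
      intro u
      by_cases hu : u ∈ S <;> simp [hc, hu]
    obtain ⟨L, hL, hL2⟩ := step_two (fun i => a (e i)) (fun i => (e i : Euc d)) hcb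
      (Subtype.val_injective.comp e.injective) (e.symm ⟨s0, hs0⟩) (by simpa using ha s0 hs0) hin
    have : Nontrivial (Euc d) := by
      have : Nonempty (Fin d) := ⟨⟨0, hd⟩⟩
      infer_instance
    obtain ⟨v, hv⟩ := exists_ne (0 : Euc d)
    refine ⟨v :: L, by simp, ?_, ?_⟩
    · intro w hw
      rcases List.mem_cons.1 hw with h | h
      · rw [h]; exact hv
      · exact hL w h
    · rw [List.foldr_cons, foldr_Delta, mem_annI.1 hL2]
      funext u
      simp [Delta]

end
end

section
/- Let d be a positive integer, let c : ℝ^d → ℂ be an ℝ^d-configuration (finite range), and let D = {d_1, …, d_m} ⊂ ℝ^d be a finite set of m distinct points. If c has low complexity with respect to D, i.e., the number of distinct functions (u ↦ c(u + t)) restricted to D, as t ranges over ℝ^d, is at most m, then there exist a_1, …, a_m ∈ ℂ, not all zero, such that the ℝ^d-polynomial f = a_1·X^{−d_1} + … + a_m·X^{−d_m} (the finitely supported function with value a_i at −d_i) periodizes c, i.e., f*c is strongly periodic. -/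
/- STATEMENT 8: Low complexity with respect to a finite shape D implies the
   existence of a non-trivial periodizer supported on −D. -/

open scoped Classical

noncomputable section

def StronglyPeriodic {d : ℕ} (c : Euc d → ℂ) : Prop :=
  ∃ t : Fin d → Euc d, LinearIndependent ℝ t ∧ ∀ i, ∀ u, c (u - t i) = c u

theorem conv_eq {d m : ℕ} (c : Euc d → ℂ) (dd : Fin m → Euc d) (a : Fin m → ℂ) (u : Euc d) :
    conv (fun x => ∑ i, if x = -(dd i) then a i else 0) c u = ∑ i, a i * c (dd i + u) := by
  unfold conv
  simp only [Finset.sum_mul]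
  rw [finsum_sum_comm]
  · refine Finset.sum_congr rfl fun i _ => ?_
    rw [finsum_eq_single _ (-(dd i))]
    · rw [if_pos rfl, sub_neg_eq_add, add_comm]
    · intro x hx
      rw [if_neg hx, zero_mul]
  · intro i _
    refine (Set.finite_singleton (-(dd i))).subset ?_
    intro x hx
    by_contra h
    apply hx
    have h' : x ≠ -(dd i) := h
    simp only [if_neg h', zero_mul]

theorem stmt_8 (d : ℕ) (hd : 0 < d) (c : Euc d → ℂ)
    (hfin : (Set.range c).Finite)
    (m : ℕ) (hm : 0 < m) (dd : Fin m → Euc d) (hinj : Function.Injective dd)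
    (hlow : ({p : Fin m → ℂ | ∃ t : Euc d, ∀ i, p i = c (dd i + t)}).ncard ≤ m) :
    ∃ a : Fin m → ℂ, a ≠ 0 ∧
      StronglyPeriodic (conv (fun x => ∑ i, if x = -(dd i) then a i else 0) c) := by
  set P : Set (Fin m → ℂ) := {p : Fin m → ℂ | ∃ t : Euc d, ∀ i, p i = c (dd i + t)} with hP
  have hPfin : P.Finite := by
    refine (Set.Finite.pi' (fun _ : Fin m => hfin)).subset ?_
    rintro p ⟨t, ht⟩ i
    exact ⟨_, (ht i).symm⟩
  haveI : Fintype P := hPfin.fintype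
  have hcard : Fintype.card P ≤ m := by
    rw [← Nat.card_eq_fintype_card]
    exact hlow
  let L : ((Fin m → ℂ) × ℂ) →ₗ[ℂ] (P → ℂ) :=
    { toFun := fun x p => (∑ i, x.1 i * p.1 i) - x.2
      map_add' := by
        intro x y
        funext p
        simp [add_mul, Finset.sum_add_distrib]
        ring
      map_smul' := by
        intro r x
        funext p
        simp [Finset.mul_sum, mul_sub, mul_assoc] }
  have hker : LinearMap.ker L ≠ ⊥ := by
    apply LinearMap.ker_ne_bot_of_finrank_lt
    simp
    omega
  obtain ⟨x, hx, hx0⟩ := (Submodule.ne_bot_iff _).1 hker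
  have hall : ∀ t : Euc d, ∑ i, x.1 i * c (dd i + t) = x.2 := by
    intro t
    have h := congrFun (LinearMap.mem_ker.1 hx) ⟨fun i => c (dd i + t), t, fun _ => rfl⟩
    exact sub_eq_zero.1 h
  refine ⟨x.1, ?_, ?_⟩
  · intro h0
    apply hx0
    refine Prod.ext h0 ?_
    rw [← hall 0, h0]
    simp
  · refine ⟨_, (EuclideanSpace.basisFun (Fin d) ℝ).toBasis.linearIndependent, ?_⟩
    intro i u
    rw [conv_eq, conv_eq, hall, hall]

end
end

section
/- Let d be a positive integer, let c : ℝ^d → ℂ be an ℝ^d-configuration (finite range), let v ∈ ℝ^d be nonzero, and let k be a positive integer. If c is annihilated by (X^v − 1)^k, i.e., the k-fold iterate Δ_v^k(c) is identically zero (equivalently, ∑_{j=0}^{k} (−1)^{k−j}·binom(k,j)·c(u − j·v) = 0 for all u ∈ ℝ^d), then c is p·v-periodic for some nonzero integer p, i.e., c(u − p·v) = c(u) for all u. -/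
/- STATEMENT 9: An ℝ^d-configuration annihilated by a power (X^v − 1)^k of a
   difference ℝ^d-polynomial is p·v-periodic for some nonzero integer p. -/

noncomputable section

theorem delta_aux {d : ℕ} (v : Euc d) (e : Euc d → ℂ) (C : ℝ) (hC : ∀ u, ‖e u‖ ≤ C)
    (h : Delta v (Delta v e) = 0) : Delta v e = 0 := by
  have h1 : ∀ u, Delta v e (u - v) = Delta v e u := fun u => by
    have := congrFun h u
    exact sub_eq_zero.mp this
  have h2 : ∀ (n : ℕ) u, Delta v e (u - (n : ℝ) • v) = Delta v e u := by
    intro n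
    induction n with
    | zero => intro u; simp
    | succ n ih =>
      intro u
      have : u - ((n + 1 : ℕ) : ℝ) • v = (u - (n : ℝ) • v) - v := by
        push_cast; rw [add_smul, one_smul]; abel
      rw [this, h1, ih]
  have h3 : ∀ (n : ℕ) u, e (u - (n : ℝ) • v) = e u + n * Delta v e u := by
    intro n
    induction n with
    | zero => intro u; simp
    | succ n ih =>
      intro u
      have : u - ((n + 1 : ℕ) : ℝ) • v = (u - (n : ℝ) • v) - v := by
        push_cast; rw [add_smul, one_smul]; abel
      have h4 : e (u - (n : ℝ) • v - v) - e (u - (n : ℝ) • v) = Delta v e u := h2 n u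
      rw [this, sub_eq_iff_eq_add.mp h4, ih]
      push_cast; ring
  funext u
  by_contra hne
  have hpos : 0 < ‖Delta v e u‖ := norm_pos_iff.mpr hne
  obtain ⟨n, hn⟩ := exists_nat_gt (2 * C / ‖Delta v e u‖)
  rw [div_lt_iff₀ hpos] at hn
  have h5 : (n : ℂ) * Delta v e u = e (u - (n : ℝ) • v) - e u := by rw [h3]; ring
  have h6 : (n : ℝ) * ‖Delta v e u‖ = ‖e (u - (n : ℝ) • v) - e u‖ := by
    rw [← h5, norm_mul, Complex.norm_natCast]
  have h7 := norm_sub_le (e (u - (n : ℝ) • v)) (e u)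
  have := hC u
  have := hC (u - (n : ℝ) • v)
  linarith

theorem delta_pow_aux {d : ℕ} (v : Euc d) (k : ℕ) : ∀ (e : Euc d → ℂ) (C : ℝ),
    (∀ u, ‖e u‖ ≤ C) → (Delta v)^[k + 1] e = 0 → Delta v e = 0 := by
  induction k with
  | zero => intro e C _ h; exact h
  | succ k ih =>
    intro e C hC h
    refine delta_aux v e C hC (ih (Delta v e) (C + C) (fun u => ?_) h)
    exact (norm_sub_le _ _).trans (add_le_add (hC _) (hC _))

theorem stmt_9 (d : ℕ) (hd : 0 < d) (c : Euc d → ℂ)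
    (hfin : (Set.range c).Finite)
    (v : Euc d) (hv : v ≠ 0) (k : ℕ) (hk : 0 < k)
    (hann : (Delta v)^[k] c = 0) :
    ∃ p : ℤ, p ≠ 0 ∧ ∀ u, c (u - (p : ℝ) • v) = c u := by
  obtain ⟨C, hC⟩ := hfin.isBounded.exists_norm_le
  obtain ⟨m, rfl⟩ := Nat.exists_eq_succ_of_ne_zero hk.ne'
  have h := delta_pow_aux v m c C (fun u => hC _ ⟨u, rfl⟩) hann
  refine ⟨1, one_ne_zero, fun u => ?_⟩
  have := congrFun h u
  simpa using sub_eq_zero.mp this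

end
end

section
/- Let c : ℝ → ℂ be a 1-dimensional Delone configuration of finite local complexity: c has finite range and its support S = {u : c(u) ≠ 0} is a Delone set in ℝ such that S − S is locally finite. If c is annihilated by some non-trivial ℝ-polynomial, then c is periodic; moreover, a period of c can be chosen from S − S. -/
/- STATEMENT 10: A 1-dimensional Delone configuration of finite local complexity
   with a non-trivial annihilator is periodic, with a period in S − S. -/

open scoped Pointwise

noncomputable section

def conv1 (f c : ℝ → ℂ) (u : ℝ) : ℂ := ∑ᶠ v, f v * c (u - v)

def Annihilates1 (f c : ℝ → ℂ) : Prop := ∀ u, conv1 f c u = 0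

def UniformlyDiscrete1 (S : Set ℝ) : Prop :=
  ∃ r > (0:ℝ), ∀ x : ℝ, (S ∩ Metric.ball x r).Subsingleton

def RelativelyDense1 (S : Set ℝ) : Prop :=
  ∃ R > (0:ℝ), ∀ x : ℝ, (S ∩ Metric.closedBall x R).Nonempty

def IsDelone1 (S : Set ℝ) : Prop := UniformlyDiscrete1 S ∧ RelativelyDense1 S

def SetLocallyFinite1 (S : Set ℝ) : Prop :=
  ∀ B : Set ℝ, Bornology.IsBounded B → (S ∩ B).Finite

theorem aux_zero (d f : ℝ → ℂ) (F : Finset ℝ) (a b p : ℝ) (ha : a ∈ F) (hb : b ∈ F)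
    (hmin : ∀ v ∈ F, a ≤ v) (hmax : ∀ v ∈ F, v ≤ b) (hfa : f a ≠ 0) (hfb : f b ≠ 0)
    (hd : ∀ x y, (Function.support d ∩ Set.Icc x y).Finite)
    (hann : ∀ u, ∑ v ∈ F, f v * d (u - v) = 0)
    (h0 : ∀ x ∈ Set.Icc p (p + (b - a)), d x = 0) : ∀ x, d x = 0 := by
  intro x
  by_contra hx
  have hx' : x < p ∨ p + (b - a) < x := by
    by_contra h
    push Not at h
    exact hx (h0 x ⟨h.1, h.2⟩)
  rcases hx' with hlt | hgt
  · obtain ⟨m, hm, hmm⟩ := (hd x (p + (b - a))).exists_maximal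
      ⟨x, hx, le_rfl, by linarith [hmin b hb]⟩
    have hmax' : ∀ y, m < y → y ≤ p + (b - a) → d y = 0 := by
      intro y h1 h2
      by_contra hy
      exact absurd (hmm ⟨hy, hm.2.1.trans h1.le, h2⟩ h1.le) (not_le.2 h1)
    have hmp : m < p := by
      by_contra h
      exact hm.1 (h0 m ⟨not_lt.1 h, hm.2.2⟩)
    have h := hann (m + b)
    rw [Finset.sum_eq_single_of_mem b hb] at h
    · rw [add_sub_cancel_right] at h
      exact (mul_ne_zero hfb hm.1) h
    · intro v hv hvb
      have h1 : v < b := lt_of_le_of_ne (hmax v hv) hvb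
      rw [hmax' (m + b - v) (by linarith) (by linarith [hmin v hv]), mul_zero]
  · obtain ⟨m, hm, hmm⟩ := (hd p x).exists_minimal
      ⟨x, hx, by linarith [hmin b hb], le_rfl⟩
    have hmin' : ∀ y, y < m → p ≤ y → d y = 0 := by
      intro y h1 h2
      by_contra hy
      exact absurd (hmm ⟨hy, h2, h1.le.trans hm.2.2⟩ h1.le) (not_le.2 h1)
    have hmp : p + (b - a) < m := by
      by_contra h
      exact hm.1 (h0 m ⟨hm.2.1, not_lt.1 h⟩)
    have h := hann (m + a)
    rw [Finset.sum_eq_single_of_mem a ha] at h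
    · rw [add_sub_cancel_right] at h
      exact (mul_ne_zero hfa hm.1) h
    · intro v hv hva
      have h1 : a < v := lt_of_le_of_ne (hmin v hv) (Ne.symm hva)
      rw [hmin' (m + a - v) (by linarith) (by linarith [hmax v hv]), mul_zero]

theorem stmt_10 (c : ℝ → ℂ)
    (hfin : (Set.range c).Finite)
    (hdelone : IsDelone1 (Function.support c))
    (hflc : SetLocallyFinite1 (Function.support c - Function.support c))
    (f : ℝ → ℂ) (hfsupp : (Function.support f).Finite) (hf0 : f ≠ 0)
    (hann : Annihilates1 f c) :
    ∃ t : ℝ, t ≠ 0 ∧ t ∈ Function.support c - Function.support c ∧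
      ∀ u, c (u - t) = c u := by
  classical
  set S := Function.support c with hS
  obtain ⟨-, R, hR, hdense⟩ := hdelone
  have hSinf : S.Infinite := by
    intro h
    obtain ⟨M, hM⟩ := h.bddAbove
    obtain ⟨y, hy, hy'⟩ := hdense (M + R + 1)
    rw [Metric.mem_closedBall, Real.dist_eq, abs_le] at hy'
    linarith [hM hy, hy'.1]
  obtain ⟨s0, hs0⟩ := hSinf.nonempty
  have hSfin : ∀ x y, (S ∩ Set.Icc x y).Finite := by
    intro x y
    have h := (hflc _ (Metric.isBounded_Icc (x - s0) (y - s0))).image (fun z => z + s0)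
    refine h.subset ?_
    rintro z ⟨hz, hz1, hz2⟩
    exact ⟨z - s0, ⟨Set.sub_mem_sub hz hs0, by linarith, by linarith⟩, by simp⟩
  set F := hfsupp.toFinset with hF
  have hFne : F.Nonempty := by
    rw [hF, Set.Finite.toFinset_nonempty]
    exact Function.support_nonempty_iff.2 hf0
  have hFm : ∀ v, v ∈ F ↔ f v ≠ 0 := by intro v; simp [hF]
  have hsum : ∀ u, ∑ v ∈ F, f v * c (u - v) = 0 := by
    intro u
    have h := hann u
    unfold conv1 at h
    rw [finsum_eq_sum_of_support_subset (s := F)] at h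
    · exact h
    · intro v hv
      rw [Finset.mem_coe, hFm]
      exact left_ne_zero_of_mul hv
  set a := F.min' hFne
  set b := F.max' hFne
  have ha : a ∈ F := F.min'_mem hFne
  have hb : b ∈ F := F.max'_mem hFne
  have hDfin := hflc _ (Metric.isBounded_Icc (-(b - a)) 0)
  set D := (S - S) ∩ Set.Icc (-(b - a)) 0
  have : Finite D := hDfin
  have : Finite (Set.range c) := hfin
  have : Infinite S := hSinf.to_subtype
  obtain ⟨s, s', hne, heq⟩ := Finite.exists_ne_map_eq_of_infinite
    (fun (s : S) (e : D) => (⟨c (s + e), Set.mem_range_self _⟩ : Set.range c))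
  have heq' : ∀ x ∈ Set.Icc (-(b - a)) 0, c (s + x) = c (s' + x) := by
    intro x hx
    by_cases hxD : x ∈ S - S
    · exact congrArg Subtype.val (congrFun heq ⟨x, hxD, hx⟩)
    · have key : ∀ r : S, c (r + x) = 0 := by
        intro r
        by_contra h
        apply hxD
        have h2 := Set.sub_mem_sub (s := S) (t := S) (show (r : ℝ) + x ∈ S from h) r.2
        rwa [add_sub_cancel_left] at h2
      rw [key, key]
  refine ⟨s - s', ?_, Set.sub_mem_sub s.2 s'.2, ?_⟩
  · intro h
    exact hne (Subtype.ext (sub_eq_zero.1 h))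
  have hz := aux_zero (fun u => c (u - (s - s')) - c u) f F a b (s - (b - a)) ha hb
    (fun v hv => F.min'_le v hv) (fun v hv => F.le_max' v hv) ((hFm a).1 ha) ((hFm b).1 hb)
    ?_ ?_ ?_
  · intro u
    exact sub_eq_zero.1 (hz u)
  · intro x y
    refine (((hSfin (x - (s - s')) (y - (s - s'))).image (fun z => z + ((s : ℝ) - (s' : ℝ)))).union
      (hSfin x y)).subset ?_
    rintro z ⟨hz, hz1, hz2⟩
    by_cases h : c z = 0
    · left
      refine ⟨z - (s - s'), ⟨?_, by linarith, by linarith⟩, by simp⟩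
      intro h'
      apply hz
      simp only [h, h', sub_zero]
    · right
      exact ⟨h, hz1, hz2⟩
  · intro u
    have h1 := hsum (u - (s - s'))
    have h2 := hsum u
    simp only [mul_sub, Finset.sum_sub_distrib]
    rw [h2, sub_zero, ← h1]
    refine Finset.sum_congr rfl fun v _ => ?_
    congr 2
    ring
  · intro x hx
    have h := heq' (x - s) ⟨by linarith [hx.1], by linarith [hx.2]⟩
    show c (x - (s - s')) - c x = 0
    rw [show (s : ℝ) + (x - s) = x by ring, show (s' : ℝ) + (x - s) = x - (s - s') by ring] at h
    rw [h, sub_self]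

end
end

section
/- Let d be a positive integer and let v_1, v_2 ∈ ℝ^d be linearly independent over ℚ (no nontrivial rational linear combination of v_1 and v_2 is zero). Let c' : ℝ^d → ℤ be any function that is annihilated by X^{v_2} − 1, i.e., c'(u − v_2) = c'(u) for all u ∈ ℝ^d. Then there exists a function c : ℝ^d → ℤ such that c(u − v_1) − c(u) = c'(u) for all u ∈ ℝ^d and c(u − v_2) = c(u) for all u ∈ ℝ^d. -/
/- STATEMENT 12: Integration lemma: a v₂-periodic integer-valued function c' is
   the Δ_{v₁}-derivative of some v₂-periodic integer-valued function c,
   provided v₁ and v₂ are linearly independent over ℚ. -/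

noncomputable section

theorem aux_int (a : ℤ → ℤ) : ∃ h : ℤ → ℤ, ∀ n, h (n - 1) - h n = a n := by
  refine ⟨fun n => ∑ i ∈ Finset.Ioc n 0, a i - ∑ i ∈ Finset.Ioc 0 n, a i, fun n => ?_⟩
  rcases le_or_gt n 0 with hn | hn
  · have h1 : Finset.Ioc (n - 1) 0 = insert n (Finset.Ioc n 0) := by
      ext x; simp only [Finset.mem_Ioc, Finset.mem_insert]; omega
    have h2 : Finset.Ioc 0 (n - 1) = ∅ := Finset.Ioc_eq_empty (by omega)
    have h3 : Finset.Ioc 0 n = ∅ := Finset.Ioc_eq_empty (by omega)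
    simp only [h1, h2, h3]
    rw [Finset.sum_insert (by simp)]
    simp
  · have h1 : Finset.Ioc 0 n = insert n (Finset.Ioc 0 (n - 1)) := by
      ext x; simp only [Finset.mem_Ioc, Finset.mem_insert]; omega
    have h2 : Finset.Ioc (n - 1) 0 = ∅ := Finset.Ioc_eq_empty (by omega)
    have h3 : Finset.Ioc n 0 = ∅ := Finset.Ioc_eq_empty (by omega)
    simp only [h1, h2, h3]
    rw [Finset.sum_insert (by simp)]
    simp

theorem aux_group {Q : Type*} [AddCommGroup Q] (g : Q) (hg : ∀ n : ℤ, n • g = 0 → n = 0)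
    (f : Q → ℤ) : ∃ F : Q → ℤ, ∀ q, F (q - g) - F q = f q := by
  let r : Q → Q := fun q => Quotient.out (QuotientAddGroup.mk q : Q ⧸ AddSubgroup.zmultiples g)
  have hr : ∀ q, ∃ n : ℤ, q = r q + n • g := by
    intro q
    have h : (QuotientAddGroup.mk (r q) : Q ⧸ AddSubgroup.zmultiples g) = QuotientAddGroup.mk q :=
      Quotient.out_eq _
    rw [QuotientAddGroup.eq] at h
    obtain ⟨n, hn⟩ := AddSubgroup.mem_zmultiples_iff.1 h
    exact ⟨n, by rw [hn]; abel⟩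
  choose n hn using hr
  have hrg : ∀ q, r (q - g) = r q := by
    intro q
    have h : (QuotientAddGroup.mk (q - g) : Q ⧸ AddSubgroup.zmultiples g)
        = QuotientAddGroup.mk q := by
      rw [QuotientAddGroup.eq]
      have : -(q - g) + q = g := by abel
      rw [this]
      exact AddSubgroup.mem_zmultiples g
    simp only [r, h]
  have hng : ∀ q, n (q - g) = n q - 1 := by
    intro q
    have h1 := hn (q - g)
    rw [hrg] at h1
    have h2 := hn q
    have h3 : (n (q - g) - n q + 1) • g = 0 := by
      have e1 : n (q - g) • g = q - g - r q := by
        rw [eq_sub_iff_add_eq, add_comm]; exact h1.symm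
      have e2 : n q • g = q - r q := by
        rw [eq_sub_iff_add_eq, add_comm]; exact h2.symm
      rw [add_smul, sub_smul, e1, e2, one_smul]; abel
    have := hg _ h3
    omega
  choose h hh using fun x : Q => aux_int (fun k => f (x + k • g))
  refine ⟨fun q => h (r q) (n q), fun q => ?_⟩
  simp only [hrg, hng]
  rw [hh, ← hn]

theorem stmt_12 (d : ℕ) (hd : 0 < d) (v₁ v₂ : Euc d)
    (hindep : ∀ a b : ℚ, (a : ℝ) • v₁ + (b : ℝ) • v₂ = 0 → a = 0 ∧ b = 0)
    (c' : Euc d → ℤ) (hc' : ∀ u, c' (u - v₂) = c' u) :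
    ∃ c : Euc d → ℤ,
      (∀ u, c (u - v₁) - c u = c' u) ∧ (∀ u, c (u - v₂) = c u) := by
  let Q := Euc d ⧸ AddSubgroup.zmultiples v₂
  have key : ∀ n : ℤ, n • (QuotientAddGroup.mk v₁ : Q) = 0 → n = 0 := by
    intro n hn
    have h : (QuotientAddGroup.mk (n • v₁) : Q) = 0 := hn
    rw [QuotientAddGroup.eq_zero_iff] at h
    obtain ⟨m, hm⟩ := AddSubgroup.mem_zmultiples_iff.1 h
    have := hindep n (-m) (by
      push_cast
      rw [neg_smul, Int.cast_smul_eq_zsmul, Int.cast_smul_eq_zsmul, hm]; abel)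
    exact_mod_cast this.1
  have hz : ∀ (m : ℤ) u, c' (u + m • v₂) = c' u := by
    intro m
    induction m using Int.induction_on with
    | zero => intro u; simp
    | succ i ih =>
      intro u
      rw [← ih u, ← hc' (u + ((i : ℤ) + 1) • v₂), add_smul, one_smul]
      congr 1; abel
    | pred i ih =>
      intro u
      rw [← ih u, ← hc' (u + (-(i : ℤ)) • v₂), sub_smul, one_smul]
      congr 1; abel
  let f : Q → ℤ := Quotient.lift c' (by
    intro a b hab
    have h := QuotientAddGroup.leftRel_apply.1 hab
    obtain ⟨m, hm⟩ := AddSubgroup.mem_zmultiples_iff.1 h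
    rw [← hz m a, hm]; congr 1; abel)
  obtain ⟨F, hF⟩ := aux_group (QuotientAddGroup.mk v₁ : Q) key f
  refine ⟨fun u => F (QuotientAddGroup.mk u), fun u => hF (QuotientAddGroup.mk u), fun u => ?_⟩
  have h : (QuotientAddGroup.mk (u - v₂) : Q) = QuotientAddGroup.mk u := by
    rw [QuotientAddGroup.eq]
    have : -(u - v₂) + u = v₂ := by abel
    rw [this]
    exact AddSubgroup.mem_zmultiples v₂
  simp only [h]

end
end

section
/- Let d be a positive integer, let c : ℝ^d → ℂ be an integral ℝ^d-configuration (finite range, all values integers), and let v_1, …, v_m ∈ ℝ^d be pairwise linearly independent over ℚ. If the product (X^{v_1}−1)⋯(X^{v_m}−1) of difference ℝ^d-polynomials annihilates c, i.e., Δ_{v_1}∘⋯∘Δ_{v_m}(c) = 0, then there exist functions c_1, …, c_m : ℝ^d → ℤ such that c = c_1 + … + c_m and each c_i is v_i-periodic (c_i(u − v_i) = c_i(u) for all u). -/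
/- STATEMENT 13: An integral ℝ^d-configuration annihilated by a product of
   difference ℝ^d-polynomials in pairwise ℚ-linearly independent directions is a
   sum of integer-valued functions periodic in those directions. -/

noncomputable section

theorem aux_Z (a : ℤ → ℤ) : ∃ F : ℤ → ℤ, ∀ n, F (n - 1) - F n = a n := by
  refine ⟨fun n => (∑ i ∈ Finset.range (-n).toNat, a (-(i : ℤ))) -
    ∑ i ∈ Finset.range n.toNat, a ((i : ℤ) + 1), fun n => ?_⟩
  dsimp only
  rcases le_or_gt n 0 with h | h
  · obtain ⟨k, rfl⟩ : ∃ k : ℕ, n = -(k : ℤ) := ⟨(-n).toNat, by omega⟩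
    have h1 : (-(-(k : ℤ) - 1)).toNat = k + 1 := by omega
    have h2 : (-(k : ℤ) - 1).toNat = 0 := by omega
    have h3 : (-(-(k : ℤ))).toNat = k := by omega
    have h4 : (-(k : ℤ)).toNat = 0 := by omega
    rw [h1, h2, h3, h4, Finset.sum_range_succ]
    simp
  · obtain ⟨k, rfl⟩ : ∃ k : ℕ, n = (k : ℤ) + 1 := ⟨(n - 1).toNat, by omega⟩
    have h1 : (-((k : ℤ) + 1 - 1)).toNat = 0 := by omega
    have h2 : ((k : ℤ) + 1 - 1).toNat = k := by omega
    have h3 : (-((k : ℤ) + 1)).toNat = 0 := by omega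
    have h4 : ((k : ℤ) + 1).toNat = k + 1 := by omega
    rw [h1, h2, h3, h4, Finset.sum_range_succ]
    simp

theorem aux_Q {Q : Type*} [AddCommGroup Q] (w : Q) (hw : ∀ k : ℤ, k • w = 0 → k = 0)
    (b : Q → ℤ) : ∃ g : Q → ℤ, ∀ u, g (u - w) - g u = b u := by
  choose F hF using fun r : Q => aux_Z (fun n => b (r + n • w))
  let H := AddSubgroup.zmultiples w
  let r : Q → Q := fun u => (QuotientAddGroup.mk u : Q ⧸ H).out
  have hr : ∀ u, ∃ n : ℤ, u = r u + n • w := by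
    intro u
    have h : (QuotientAddGroup.mk (r u) : Q ⧸ H) = QuotientAddGroup.mk u :=
      Quotient.out_eq _
    rw [QuotientAddGroup.eq] at h
    obtain ⟨n, hn⟩ := AddSubgroup.mem_zmultiples_iff.1 h
    exact ⟨n, by rw [hn]; abel⟩
  choose n hn using hr
  have hrw : ∀ u, r (u - w) = r u := by
    intro u
    have : (QuotientAddGroup.mk (u - w) : Q ⧸ H) = QuotientAddGroup.mk u := by
      rw [QuotientAddGroup.eq]
      have : -(u - w) + u = w := by abel
      rw [this]
      exact AddSubgroup.mem_zmultiples w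
    simp only [r, this]
  have hnw : ∀ u, n (u - w) = n u - 1 := by
    intro u
    have h1 := hn (u - w)
    rw [hrw] at h1
    have h2 := hn u
    have : (n (u - w) - n u + 1) • w = 0 := by
      rw [add_smul, sub_smul, one_smul]
      have e1 : n (u - w) • w = u - w - r u := by
        rw [eq_sub_iff_add_eq, add_comm]; exact h1.symm
      have e2 : n u • w = u - r u := by
        rw [eq_sub_iff_add_eq, add_comm]; exact h2.symm
      rw [e1, e2]; abel
    have := hw _ this
    omega
  refine ⟨fun u => F (r u) (n u), fun u => ?_⟩
  dsimp only
  rw [hrw, hnw, hF, ← hn]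

theorem aux_A {A : Type*} [AddCommGroup A] (v w : A)
    (hw : ∀ k l : ℤ, k • w = l • v → k = 0)
    (b : A → ℤ) (hb : ∀ u, b (u - v) = b u) :
    ∃ g : A → ℤ, (∀ u, g (u - v) = g u) ∧ ∀ u, g (u - w) - g u = b u := by
  let H := AddSubgroup.zmultiples v
  have hper : ∀ (l : ℤ) u, b (u + l • v) = b u := by
    intro l
    induction l using Int.induction_on with
    | zero => simp
    | succ i ih =>
      intro u
      rw [← ih u, ← hb (u + ((i : ℤ) + 1) • v)]
      congr 1
      rw [add_smul, one_smul]; abel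
    | pred i ih =>
      intro u
      rw [← ih u, ← hb (u + (-(i : ℤ)) • v)]
      congr 1
      rw [sub_smul, one_smul]; abel
  have hout : ∀ u, b ((QuotientAddGroup.mk u : A ⧸ H).out) = b u := by
    intro u
    have h : (QuotientAddGroup.mk u : A ⧸ H) =
      QuotientAddGroup.mk ((QuotientAddGroup.mk u : A ⧸ H).out) :=
      (Quotient.out_eq _).symm
    rw [QuotientAddGroup.eq] at h
    obtain ⟨n, hn⟩ := AddSubgroup.mem_zmultiples_iff.1 h
    rw [← hper n u, hn]
    congr 1
    abel
  obtain ⟨g, hg⟩ := aux_Q (QuotientAddGroup.mk w : A ⧸ H) (by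
    intro k hk
    have : (QuotientAddGroup.mk (k • w) : A ⧸ H) = 0 := hk
    rw [QuotientAddGroup.eq_zero_iff] at this
    obtain ⟨l, hl⟩ := AddSubgroup.mem_zmultiples_iff.1 this
    exact hw k l hl.symm) (fun q => b q.out)
  refine ⟨fun u => g (QuotientAddGroup.mk u), fun u => ?_, fun u => ?_⟩
  · have : (QuotientAddGroup.mk (u - v) : A ⧸ H) = QuotientAddGroup.mk u := by
      rw [QuotientAddGroup.eq]
      have : -(u - v) + u = v := by abel
      rw [this]
      exact AddSubgroup.mem_zmultiples v
    dsimp only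
    rw [this]
  · have := hg (QuotientAddGroup.mk u)
    rw [hout] at this
    exact this

theorem Delta_comm' {d : ℕ} (v w : Euc d) (c : Euc d → ℂ) :
    Delta v (Delta w c) = Delta w (Delta v c) := by
  funext u
  simp only [Delta]
  rw [sub_right_comm u v w]
  ring

theorem foldr_Delta_s13 {d : ℕ} (w : Euc d) (l : List (Euc d)) (c : Euc d → ℂ) :
    Delta w (l.foldr Delta c) = l.foldr Delta (Delta w c) := by
  induction l with
  | nil => rfl
  | cons a l ih => rw [List.foldr_cons, List.foldr_cons, Delta_comm', ih]

theorem aux_main (d : ℕ) (m : ℕ) : ∀ (c : Euc d → ℂ)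
    (_ : ∀ u, ∃ n : ℤ, c u = (n : ℂ)) (v : Fin m → Euc d)
    (_ : ∀ i j, i ≠ j → ∀ a b : ℚ, (a : ℝ) • v i + (b : ℝ) • v j = 0 → a = 0 ∧ b = 0)
    (_ : (List.ofFn v).foldr Delta c = 0),
    ∃ cs : Fin m → Euc d → ℤ,
      (∀ u, c u = ∑ i, (cs i u : ℂ)) ∧
      (∀ i, ∀ u, cs i (u - v i) = cs i u) := by
  induction m with
  | zero =>
    intro c _ v _ h
    refine ⟨fun _ _ => 0, fun u => ?_, fun i => i.elim0⟩
    simp at h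
    simp [h]
  | succ m ih =>
    intro c hint v hindep h
    rw [List.ofFn_succ, List.foldr_cons, foldr_Delta_s13] at h
    obtain ⟨bs, hbs, hper⟩ := ih (Delta (v 0) c) (by
      intro u
      obtain ⟨p, hp⟩ := hint (u - v 0)
      obtain ⟨q, hq⟩ := hint u
      exact ⟨p - q, by simp [Delta, hp, hq]⟩) (fun i => v i.succ)
      (fun i j hij => hindep _ _ (fun e => hij (Fin.succ_injective _ e))) h
    choose g hg1 hg2 using fun i : Fin m => aux_A (v i.succ) (v 0) (by
      intro k l hkl
      have := (hindep 0 i.succ (Fin.succ_ne_zero i).symm k (-l : ℤ) (by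
        push_cast
        rw [neg_smul, Int.cast_smul_eq_zsmul, Int.cast_smul_eq_zsmul, hkl, add_neg_cancel])).1
      exact_mod_cast this) (bs i) (hper i)
    choose z hz using hint
    refine ⟨Fin.cons (fun u => z u - ∑ i, g i u) g, fun u => ?_, fun i => ?_⟩
    · rw [Fin.sum_univ_succ]
      simp [hz]
    · refine Fin.cases ?_ (fun i => ?_) i
      · intro u
        simp only [Fin.cons_zero]
        have h1 := hbs u
        simp only [Delta, hz] at h1
        have h2 : z (u - v 0) - z u = ∑ i, bs i u := by exact_mod_cast h1
        have h3 : ∑ i, g i (u - v 0) - ∑ i, g i u = ∑ i, bs i u := by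
          rw [← Finset.sum_sub_distrib]
          exact Finset.sum_congr rfl fun i _ => hg2 i u
        linarith
      · intro u
        simp only [Fin.cons_succ]
        exact hg1 i u

theorem stmt_13 (d : ℕ) (hd : 0 < d) (c : Euc d → ℂ)
    (hfin : (Set.range c).Finite) (hint : ∀ u, ∃ n : ℤ, c u = (n : ℂ))
    (m : ℕ) (v : Fin m → Euc d)
    (hindep : ∀ i j, i ≠ j → ∀ a b : ℚ, (a : ℝ) • v i + (b : ℝ) • v j = 0 → a = 0 ∧ b = 0)
    (hann : (List.ofFn v).foldr Delta c = 0) :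
    ∃ cs : Fin m → Euc d → ℤ,
      (∀ u, c u = ∑ i, (cs i u : ℂ)) ∧
      (∀ i, ∀ u, cs i (u - v i) = cs i u) := by
  exact aux_main d m c hint v hindep hann

end
end

section
/- Let d be a positive integer and let S ⊆ ℝ^d be a Meyer set. Then the set S + S − S = {s_1 + s_2 − s_3 : s_1, s_2, s_3 ∈ S} is locally finite. -/
/- STATEMENT 16: For a Meyer set S, the set S + S − S is locally finite. -/

open scoped Pointwise

noncomputable section

def SetLocallyFinite {d : ℕ} (S : Set (Euc d)) : Prop :=
  ∀ B : Set (Euc d), Bornology.IsBounded B → (S ∩ B).Finite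

lemma chain_aux {E : Type*} [AddCommGroup E] (G : Set E) (hG : G.Finite) (N : ℕ) :
    ∃ H : Set E, H.Finite ∧ ∀ V : Finset E, V.card ≤ N → ∀ (m : ℕ) (v : ℕ → E),
      (∀ i ≤ m, v i ∈ V) → (∀ i < m, v (i+1) - v i ∈ G) → v m - v 0 ∈ H := by
  classical
  induction N with
  | zero =>
    refine ⟨∅, Set.finite_empty, ?_⟩
    intro V hV m v hv _
    have h0 := hv 0 (Nat.zero_le _)
    have : V = ∅ := Finset.card_eq_zero.mp (Nat.le_zero.mp hV)
    simp [this] at h0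
  | succ N ih =>
    obtain ⟨H, hH, hc⟩ := ih
    refine ⟨insert 0 (G + H), (hG.add hH).insert 0, ?_⟩
    intro V hV m v hv hg
    by_cases hm : v m = v 0
    · left; simp [hm]
    right
    set j := Nat.findGreatest (fun j => v j = v 0) m with hj
    have hjm : j ≤ m := Nat.findGreatest_le m
    have hjv : v j = v 0 :=
      Nat.findGreatest_spec (P := fun j => v j = v 0) (Nat.zero_le m) rfl
    have hjlt : j < m := lt_of_le_of_ne hjm (fun h => hm (by rw [← h]; exact hjv))
    have hgt : ∀ k, j < k → k ≤ m → v k ≠ v 0 := fun k h1 h2 =>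
      Nat.findGreatest_is_greatest (P := fun j => v j = v 0) h1 h2
    have key := hc (V.erase (v 0)) (by
        rw [Finset.card_erase_of_mem (hv 0 (Nat.zero_le _))]; omega)
      (m - (j+1)) (fun i => v (j+1+i))
      (fun i hi => Finset.mem_erase.mpr ⟨hgt _ (by omega) (by omega), hv _ (by omega)⟩)
      (fun i hi => hg (j+1+i) (by omega))
    have e : j + 1 + (m - (j+1)) = m := by omega
    simp only [e, add_zero] at key
    refine Set.mem_add.mpr ⟨v (j+1) - v j, hg j hjlt, _, key, ?_⟩
    rw [hjv]; abel

lemma ud_card {d : ℕ} {D : Set (Euc d)} (hD : UniformlyDiscrete D) (ρ : ℝ) :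
    ∃ N : ℕ, ∀ x : Euc d, ∃ V : Finset (Euc d), V.card ≤ N ∧
      (V : Set (Euc d)) = D ∩ Metric.closedBall x ρ := by
  classical
  obtain ⟨r, hr, h⟩ := hD
  obtain ⟨t, -, htf, ht⟩ := (isCompact_closedBall (0 : Euc d) ρ).finite_cover_balls hr
  refine ⟨htf.toFinset.card, fun x => ?_⟩
  have hex : ∀ y ∈ D ∩ Metric.closedBall x ρ, ∃ c ∈ t, y ∈ Metric.ball (x + c) r := by
    intro y hy
    have : y - x ∈ Metric.closedBall (0 : Euc d) ρ := by
      simpa [dist_eq_norm] using hy.2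
    have := ht this
    simp only [Set.mem_iUnion] at this
    obtain ⟨c, hc, hyc⟩ := this
    refine ⟨c, hc, ?_⟩
    rw [Metric.mem_ball, dist_eq_norm] at hyc ⊢
    rwa [← sub_sub]
  choose! f hf hfb using hex
  have hinj : Set.InjOn f (D ∩ Metric.closedBall x ρ) := by
    intro y hy z hz hyz
    refine h (x + f y) ⟨hy.1, hfb y hy⟩ ⟨hz.1, ?_⟩
    rw [hyz]; exact hfb z hz
  have hfin : (D ∩ Metric.closedBall x ρ).Finite :=
    Set.Finite.of_injOn (f := f) (t := t) hf hinj htf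
  refine ⟨hfin.toFinset, ?_, by simp⟩
  apply Finset.card_le_card_of_injOn f
  · intro y hy
    simp only [Set.Finite.coe_toFinset] at hy ⊢
    exact hf y hy
  · simpa using hinj

theorem stmt_16 (d : ℕ) (hd : 0 < d) (S : Set (Euc d)) (hS : IsMeyer S) :
    SetLocallyFinite (S + S - S) := by
  classical
  obtain ⟨⟨-, R, hR, hRd⟩, hU, -⟩ := hS
  have hsel : ∀ x : Euc d, ∃ y ∈ S, dist y x ≤ R ∧ (x ∈ S → y = x) := by
    intro x
    by_cases hx : x ∈ S
    · exact ⟨x, hx, by simpa using hR.le, fun _ => rfl⟩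
    · obtain ⟨y, hy, hyx⟩ := hRd x
      exact ⟨y, hy, hyx, fun h => absurd h hx⟩
  choose c hcS hcd hcf using hsel
  have hfin : ∀ ρ : ℝ, ((S - S) ∩ Metric.closedBall 0 ρ).Finite := by
    intro ρ
    obtain ⟨N, hN⟩ := ud_card hU ρ
    obtain ⟨V, -, hV⟩ := hN 0
    rw [← hV]; exact V.finite_toSet
  set F := (S - S) ∩ Metric.closedBall (0 : Euc d) (2*R+1) with hF
  obtain ⟨N, hN⟩ := ud_card hU (2*R)
  obtain ⟨H, hH, hchain⟩ := chain_aux (F - F) ((hfin _).sub (hfin _)) N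
  set s0 := c 0
  intro B hB
  obtain ⟨M, hM⟩ := hB.subset_closedBall (0 : Euc d)
  refine ((((hfin (M + ‖s0‖ + R)).add hH).add (Set.finite_singleton s0))).subset ?_
  rintro _ ⟨⟨_, ⟨s1, h1, s2, h2, rfl⟩, s3, h3, rfl⟩, hb⟩
  have hb := hM hb
  simp only [mem_closedBall_zero_iff] at hb
  have h0 : s0 ∈ S := hcS 0
  set d1 := s0 - s2 with hd1
  obtain ⟨V, hVc, hV⟩ := hN d1
  obtain ⟨m, hm⟩ := exists_nat_ge (‖s3 - s2‖ + 1)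
  have hm0 : (0:ℝ) < m := by have := norm_nonneg (s3 - s2); linarith
  let p : ℕ → Euc d := fun i => s2 + ((i:ℝ)/m) • (s3 - s2)
  have hp : ∀ i, ‖p (i+1) - p i‖ ≤ 1 := by
    intro i
    have : p (i+1) - p i = ((1:ℝ)/m) • (s3 - s2) := by
      simp only [p]
      rw [add_sub_add_left_eq_sub, ← sub_smul]
      congr 1
      push_cast; ring
    rw [this, norm_smul, Real.norm_of_nonneg (by positivity), div_mul_eq_mul_div,
      div_le_one hm0]
    linarith
  have hp0 : p 0 = s2 := by simp [p]
  have hpm : p m = s3 := by simp [p, div_self hm0.ne']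
  have hstep : ∀ x y : Euc d, ‖y - x‖ ≤ 1 → c y - c x ∈ F := by
    intro x y hxy
    refine ⟨Set.sub_mem_sub (hcS y) (hcS x), ?_⟩
    rw [mem_closedBall_zero_iff]
    have e : c y - c x = (c y - y) - (c x - x) + (y - x) := by abel
    have hx := hcd x
    have hy := hcd y
    rw [dist_eq_norm] at hx hy
    rw [e]
    linarith [norm_add_le ((c y - y) - (c x - x)) (y - x), norm_sub_le (c y - y) (c x - x)]
  have key := hchain V hVc m (fun i => c (p i + d1) - c (p i))
    (by
      intro i _
      rw [← Finset.mem_coe, hV]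
      refine ⟨Set.sub_mem_sub (hcS _) (hcS _), ?_⟩
      rw [Metric.mem_closedBall, dist_eq_norm]
      have hx := hcd (p i)
      have hy := hcd (p i + d1)
      rw [dist_eq_norm] at hx hy
      have e : c (p i + d1) - c (p i) - d1 = (c (p i + d1) - (p i + d1)) - (c (p i) - p i) := by
        abel
      rw [e]
      linarith [norm_sub_le (c (p i + d1) - (p i + d1)) (c (p i) - p i)])
    (by
      intro i _
      have e : c (p (i+1) + d1) - c (p (i+1)) - (c (p i + d1) - c (p i))
        = (c (p (i+1) + d1) - c (p i + d1)) - (c (p (i+1)) - c (p i)) := by abel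
      simp only [e]
      exact Set.sub_mem_sub (hstep _ _ (by simpa using hp i)) (hstep _ _ (hp i)))
  have e0 : s2 + d1 = s0 := by simp [hd1]
  simp only [hp0, hpm, e0, hcf _ h0, hcf _ h2, hcf _ h3] at key
  refine Set.mem_add.mpr ⟨_, Set.mem_add.mpr ⟨s1 - c (s3 + d1), ⟨Set.sub_mem_sub h1 (hcS _), ?_⟩,
    _, key, rfl⟩, s0, rfl, ?_⟩
  · rw [mem_closedBall_zero_iff]
    have hy := hcd (s3 + d1)
    rw [dist_eq_norm] at hy
    have e : s1 - c (s3 + d1) = ((s1 + s2 - s3) - s0) - (c (s3 + d1) - (s3 + d1)) := by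
      rw [hd1]; abel
    rw [e]
    linarith [norm_sub_le ((s1 + s2 - s3) - s0) (c (s3 + d1) - (s3 + d1)),
      norm_sub_le (s1 + s2 - s3) s0]
  · simp only; abel

end
end

section
/- Let d be a positive integer, let S ⊆ ℝ^d be a Meyer set, and let R > 0 be such that every closed ball of radius R contains a point of S. Let U = (S + S − S) ∩ B_R(0) and, for T ≥ 0, let H_T = U ∪ (S ∩ B_T(0)), where B_T(0) denotes the closed ball of radius T centered at the origin. For every t ∈ ℝ^d: if S ∩ (H_T + t) ≠ ∅, then S ∩ (U + t) ≠ ∅. -/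
/- STATEMENT 17: For a Meyer set S with covering constant R, any non-empty
   H_T-pattern of S contains a point already in its U-part. -/

open scoped Pointwise

noncomputable section

theorem stmt_17 (d : ℕ) (hd : 0 < d) (S : Set (Euc d)) (hS : IsMeyer S)
    (R : ℝ) (hR : 0 < R) (hRdense : ∀ x : Euc d, (S ∩ Metric.closedBall x R).Nonempty)
    (U : Set (Euc d)) (hU : U = (S + S - S) ∩ Metric.closedBall 0 R)
    (T : ℝ) (hT : 0 ≤ T) (HT : Set (Euc d)) (hHT : HT = U ∪ (S ∩ Metric.closedBall 0 T))
    (t : Euc d) (hne : (S ∩ (HT + {t})).Nonempty) :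
    (S ∩ (U + {t})).Nonempty := by
  subst hHT
  obtain ⟨s, hs, hst⟩ := hne
  obtain ⟨h, hh, t', ht', hsum⟩ := Set.mem_add.1 hst
  rw [Set.mem_singleton_iff] at ht'
  subst ht'
  rcases hh with hh | hh
  · exact ⟨s, hs, Set.mem_add.2 ⟨h, hh, t', rfl, hsum⟩⟩
  · obtain ⟨p, hp, hpt⟩ := hRdense t'
    refine ⟨p, hp, Set.mem_add.2 ⟨p - t', ?_, t', rfl, sub_add_cancel _ _⟩⟩
    rw [hU]
    refine ⟨Set.mem_sub.2 ⟨p + h, Set.add_mem_add hp hh.1, s, hs, ?_⟩, ?_⟩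
    · rw [← hsum]; abel
    · rw [mem_closedBall_zero_iff]
      rwa [Metric.mem_closedBall, dist_eq_norm] at hpt

end
end

section
/- Let z_1, z_2 ∈ [0,1) and let α be a nonzero real number. Define c : ℤ² → ℤ by c(i,j) = 1 if frac(z_1 + i·α) + frac(z_2 + j·α) ≥ 1 and c(i,j) = 0 otherwise (frac denotes fractional part). Then for all (i,j) ∈ ℤ²: c(i,j) = ⌊z_1 + z_2 + (i+j)·α⌋ − ⌊z_1 + i·α⌋ − ⌊z_2 + j·α⌋. Consequently, c is annihilated by the polynomial (X^{(1,−1)} − 1)(X^{(0,1)} − 1)(X^{(1,0)} − 1), i.e., Δ_{(1,−1)}∘Δ_{(0,1)}∘Δ_{(1,0)}(c) = 0, where (Δ_v c)(u) = c(u − v) − c(u) for u, v ∈ ℤ². -/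
/- STATEMENT 19: The torus-rotation configuration c(i,j) equals a difference of
   floors and is annihilated by (X^{(1,−1)}−1)(X^{(0,1)}−1)(X^{(1,0)}−1). -/

noncomputable section

/-- The difference operator Δ_v on functions ℤ² → ℤ. -/
def DeltaZ (v : ℤ × ℤ) (c : ℤ × ℤ → ℤ) : ℤ × ℤ → ℤ := fun u => c (u - v) - c u

theorem stmt_19 (z₁ z₂ : ℝ) (hz₁ : z₁ ∈ Set.Ico (0:ℝ) 1) (hz₂ : z₂ ∈ Set.Ico (0:ℝ) 1)
    (α : ℝ) (hα : α ≠ 0) (c : ℤ × ℤ → ℤ)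
    (hc : ∀ i j : ℤ,
      c (i, j) = if 1 ≤ Int.fract (z₁ + (i : ℝ) * α) + Int.fract (z₂ + (j : ℝ) * α)
        then 1 else 0) :
    (∀ i j : ℤ,
      c (i, j) = ⌊z₁ + z₂ + ((i : ℝ) + (j : ℝ)) * α⌋ - ⌊z₁ + (i : ℝ) * α⌋
        - ⌊z₂ + (j : ℝ) * α⌋) ∧
    DeltaZ (1, -1) (DeltaZ (0, 1) (DeltaZ (1, 0) c)) = 0 := by
  have key : ∀ i j : ℤ,
      c (i, j) = ⌊z₁ + z₂ + ((i : ℝ) + (j : ℝ)) * α⌋ - ⌊z₁ + (i : ℝ) * α⌋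
        - ⌊z₂ + (j : ℝ) * α⌋ := by
    intro i j
    rw [hc]
    have e : z₁ + z₂ + ((i : ℝ) + (j : ℝ)) * α = (z₁ + i * α) + (z₂ + j * α) := by ring
    rw [e]
    generalize z₁ + (i : ℝ) * α = x
    generalize z₂ + (j : ℝ) * α = y
    have hx := Int.floor_add_fract x
    have hy := Int.floor_add_fract y
    have hx0 := Int.fract_nonneg x
    have hy0 := Int.fract_nonneg y
    have hx1 := Int.fract_lt_one x
    have hy1 := Int.fract_lt_one y
    split_ifs with h
    · have : ⌊x + y⌋ = ⌊x⌋ + ⌊y⌋ + 1 := by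
        rw [Int.floor_eq_iff]; push_cast; constructor <;> linarith
      omega
    · have : ⌊x + y⌋ = ⌊x⌋ + ⌊y⌋ := by
        rw [Int.floor_eq_iff]; push_cast; constructor <;> linarith
      omega
  refine ⟨key, ?_⟩
  obtain ⟨F, G, H, h⟩ : ∃ F G H : ℤ → ℤ, ∀ i j, c (i, j) = F (i + j) - G i - H j :=
    ⟨fun n => ⌊z₁ + z₂ + (n : ℝ) * α⌋, fun n => ⌊z₁ + (n : ℝ) * α⌋,
      fun n => ⌊z₂ + (n : ℝ) * α⌋, fun i j => by rw [key]; push_cast; rfl⟩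
  funext ⟨i, j⟩
  simp only [DeltaZ, Prod.mk_sub_mk, h, Pi.zero_apply]
  ring_nf

end
end
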